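/- arXiv:2404.05609 — 2 statements merged into one kernel-verified Lean document; each statement's English description precedes it below -/
import Mathlib

section
/- Let n ≥ 3, γ > 0, and let A be an invertible n×n complex matrix. Then det(I + A·B) ≠ 0 for every n×n matrix B such that H(B) and γ²·I − B*B are positive semidefinite (i.e., for every B ∈ S_γ(π/2)) if and only if there exist nonnegative real numbers k₁, k₂ such that the Hermitian matrix k₁·(I − γ²·A*A) + k₂·H(A) is positive definite. -/
open Matrix
open scoped ComplexOrder

noncomputable section

/-- Hermitian part of a complex matrix: `H(A) = (A + A*) / 2`. -/
def Hpart {n : ℕ} (A : Matrix (Fin n) (Fin n) ℂ) : Matrix (Fin n) (Fin n) ℂ :=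
  (2⁻¹ : ℂ) • (A + Aᴴ)

open scoped InnerProductSpace

section NumericalRange

variable {E : Type*} [NormedAddCommGroup E] [InnerProductSpace ℂ E]

lemma exists_norm_eq_one_im_eq_zero (p q : ℂ) :
    ∃ c : ℂ, ‖c‖ = 1 ∧ (star c * p + c * q).im = 0 := by
  obtain ⟨c, hc, h⟩ := RCLike.exists_norm_eq_mul_self (q - star p)
  replace h := congrArg Complex.im h
  refine ⟨c, hc, ?_⟩
  simp at h ⊢
  linarith

lemma exists_inner_eq_mul_norm_sq (T : E →ₗ[ℂ] E) {u v : E} (hu : u ≠ 0) (hv : ‖v‖ = 1)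
    (hTu : ⟪u, T u⟫_ℂ = 0) (hTv : ⟪v, T v⟫_ℂ = 1) {t : ℝ} (ht0 : 0 ≤ t) (ht1 : t ≤ 1) :
    ∃ z : E, z ≠ 0 ∧ ⟪z, T z⟫_ℂ = ((t * ‖z‖ ^ 2 : ℝ) : ℂ) := by
  obtain ⟨c, hc, him⟩ := exists_norm_eq_one_im_eq_zero ⟪u, T v⟫_ℂ ⟪v, T u⟫_ℂ
  set r : ℝ := (star c * ⟪u, T v⟫_ℂ + c * ⟪v, T u⟫_ℂ).re with hr
  have hrc : star c * ⟪u, T v⟫_ℂ + c * ⟪v, T u⟫_ℂ = r :=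
    Complex.ext (by simp [hr]) (by simpa using him)
  let z : ℝ → E := fun s => ((1 - s : ℝ) : ℂ) • c • u + (s : ℂ) • v
  have hz : ∀ s, ⟪z s, T (z s)⟫_ℂ = ((s ^ 2 + s * (1 - s) * r : ℝ) : ℂ) := by
    intro s
    simp only [z, map_add, map_smul, inner_add_left, inner_add_right, inner_smul_left,
      inner_smul_right, hTu, hTv, Complex.conj_ofReal]
    push_cast
    rw [← hrc]
    simp only [RCLike.star_def]
    ring
  have hcont : Continuous fun s : ℝ => s ^ 2 + s * (1 - s) * r - t * ‖z s‖ ^ 2 := by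
    fun_prop
  obtain ⟨s, -, hs⟩ := intermediate_value_Icc (zero_le_one' ℝ) hcont.continuousOn
    (show (0 : ℝ) ∈ _ by
      refine ⟨?_, ?_⟩
      · have := mul_nonneg ht0 (sq_nonneg ‖z 0‖)
        simpa using this
      · simpa [z, hv] using ht1)
  refine ⟨z s, fun h0 => ?_, ?_⟩
  · have hsv : (s : ℂ) • v = -(((1 - s : ℝ) : ℂ) • c • u) := by
      rw [eq_neg_iff_add_eq_zero, add_comm]; exact h0
    have h1 : ⟪(s : ℂ) • v, T ((s : ℂ) • v)⟫_ℂ = 0 := by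
      rw [hsv]; simp [inner_smul_left, inner_smul_right, hTu]
    have hs0 : s = 0 := by simpa [inner_smul_left, inner_smul_right, hTv] using h1
    subst hs0
    have hc0 : c ≠ 0 := norm_ne_zero_iff.1 (by simp [hc])
    simp [z, hc0, hu] at h0
  · rw [hz]
    exact congrArg _ (by simpa [sub_eq_zero] using hs)

/-- The Toeplitz-Hausdorff theorem: the numerical range of a linear operator is convex. -/
theorem convex_numericalRange (T : E →ₗ[ℂ] E) :
    Convex ℝ ((fun x : E => ⟪x, T x⟫_ℂ) '' Metric.sphere 0 1) := by
  rw [convex_iff_forall_pos]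
  rintro _ ⟨u, hu, rfl⟩ _ ⟨v, hv, rfl⟩ s t hs ht hst
  simp only [mem_sphere_zero_iff_norm] at hu hv
  simp only
  by_cases hab : ⟪u, T u⟫_ℂ = ⟪v, T v⟫_ℂ
  · refine ⟨u, by simpa using hu, ?_⟩
    simp only
    rw [← hab, ← add_smul, hst, one_smul]
  have hd : ⟪v, T v⟫_ℂ - ⟪u, T u⟫_ℂ ≠ 0 := sub_ne_zero.2 (Ne.symm hab)
  have key : ∀ x : E,
      ⟪x, ((⟪v, T v⟫_ℂ - ⟪u, T u⟫_ℂ)⁻¹ • (T - ⟪u, T u⟫_ℂ • LinearMap.id) : E →ₗ[ℂ] E) x⟫_ℂ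
      = (⟪v, T v⟫_ℂ - ⟪u, T u⟫_ℂ)⁻¹ * (⟪x, T x⟫_ℂ - ⟪u, T u⟫_ℂ * (‖x‖ : ℂ) ^ 2) := by
    intro x
    simp [inner_self_eq_norm_sq_to_K]
  obtain ⟨z, hz0, hz⟩ := exists_inner_eq_mul_norm_sq _
    (norm_ne_zero_iff.1 (hu.trans_ne one_ne_zero)) hv
    ((key u).trans (by simp [hu])) ((key v).trans (by simp [hv, hd])) ht.le (by linarith)
  rw [key, inv_mul_eq_iff_eq_mul₀ hd] at hz
  have hn : (‖z‖ : ℂ) ≠ 0 := by simpa using hz0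
  refine ⟨((‖z‖⁻¹ : ℝ) : ℂ) • z, ?_, ?_⟩
  · simp [norm_smul, norm_ne_zero_iff.2 hz0]
  · simp only [map_smul, inner_smul_left, inner_smul_right, Complex.conj_ofReal,
      Complex.real_smul]
    rw [sub_eq_iff_eq_add.1 hz, show s = 1 - t by linarith]
    push_cast
    field_simp
    ring

/-- If no nonzero vector has its quadratic value in the closed third quadrant, some nonnegative
combination of the real and imaginary parts of the quadratic form is positive definite. -/
theorem exists_nonneg_combination_pos [FiniteDimensional ℂ E] (T : E →ₗ[ℂ] E)
    (h : ∀ x : E, x ≠ 0 → ¬ ((⟪x, T x⟫_ℂ).re ≤ 0 ∧ (⟪x, T x⟫_ℂ).im ≤ 0)) :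
    ∃ k₁ k₂ : ℝ, 0 ≤ k₁ ∧ 0 ≤ k₂ ∧
      ∀ x : E, x ≠ 0 → 0 < k₁ * (⟪x, T x⟫_ℂ).re + k₂ * (⟪x, T x⟫_ℂ).im := by
  have : ProperSpace E := FiniteDimensional.proper ℂ E
  have hcont : Continuous fun x : E => ⟪x, T x⟫_ℂ :=
    continuous_id.inner T.continuous_of_finiteDimensional
  have hclosed : IsClosed (Set.Iic (0 : ℝ) ×ℂ Set.Iic (0 : ℝ)) := isClosed_Iic.reProdIm isClosed_Iic
  have hconvex : Convex ℝ (Set.Iic (0 : ℝ) ×ℂ Set.Iic (0 : ℝ)) :=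
    ((convex_Iic 0).linear_preimage Complex.reLm).inter
      ((convex_Iic 0).linear_preimage Complex.imLm)
  have hdisj : Disjoint ((fun x : E => ⟪x, T x⟫_ℂ) '' Metric.sphere 0 1)
      (Set.Iic (0 : ℝ) ×ℂ Set.Iic (0 : ℝ)) := by
    rw [Set.disjoint_left]
    rintro _ ⟨x, hx, rfl⟩ hmem
    exact h x (ne_zero_of_mem_unit_sphere (⟨x, hx⟩ : Metric.sphere (0 : E) 1)) hmem
  obtain ⟨l, a, b, hla, hab, hlb⟩ := geometric_hahn_banach_compact_closed
    (convex_numericalRange T) ((isCompact_sphere 0 1).image hcont) hconvex hclosed hdisj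
  have hl : ∀ z : ℂ, l z = z.re * l 1 + z.im * l Complex.I := by
    intro z
    conv_lhs => rw [show z = z.re • (1 : ℂ) + z.im • Complex.I by simp]
    rw [map_add, map_smul, map_smul, smul_eq_mul, smul_eq_mul]
  have hb0 : b < 0 := by simpa using hlb 0 (by simp [Complex.mem_reProdIm])
  have hcone : ∀ e : ℂ, (∀ r : ℝ, 0 ≤ r → r • -e ∈ Set.Iic (0 : ℝ) ×ℂ Set.Iic (0 : ℝ)) →
      l e ≤ 0 := by
    intro e he
    by_contra! hpos
    have := hlb _ (he (-b / l e) (div_nonneg (by linarith) hpos.le))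
    rw [map_smul, map_neg, smul_eq_mul] at this
    field_simp at this
    linarith
  refine ⟨-l 1, -l Complex.I, ?_, ?_, fun x hx => ?_⟩
  · exact neg_nonneg.2 (hcone 1 fun r hr => by simpa [Complex.mem_reProdIm] using hr)
  · exact neg_nonneg.2 (hcone _ fun r hr => by simpa [Complex.mem_reProdIm] using hr)
  · have hn : 0 < ‖x‖ := norm_pos_iff.2 hx
    have := hla _ ⟨((‖x‖⁻¹ : ℝ) : ℂ) • x, by simp [norm_smul, hn.ne'], rfl⟩
    simp only [map_smul, inner_smul_left, inner_smul_right, Complex.conj_ofReal] at this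
    rw [hl, Complex.re_ofReal_mul, Complex.re_ofReal_mul, Complex.im_ofReal_mul,
      Complex.im_ofReal_mul] at this
    have h2 : ‖x‖⁻¹ * (‖x‖⁻¹ * ((⟪x, T x⟫_ℂ).re * l 1 + (⟪x, T x⟫_ℂ).im * l Complex.I)) < 0 := by
      linarith
    have hi : 0 < ‖x‖⁻¹ := inv_pos.2 hn
    have h3 := neg_of_mul_neg_right (neg_of_mul_neg_right h2 hi.le) hi.le
    linarith

end NumericalRange

section Interpolation

variable {E : Type*} [NormedAddCommGroup E] [InnerProductSpace ℂ E]

/-- A multiple of a unitary on the span of `x` and `w`, with Hermitian part a multiple of the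
identity, which sends the unit vector `x` to `a • x + w` when `w` is orthogonal to `x`. -/
def halfDiskMap (a : ℂ) (x w : E) : E →ₗ[ℂ] E :=
  star a • LinearMap.id + ((a - star a) • innerₛₗ ℂ x - innerₛₗ ℂ w).smulRight x
    + (innerₛₗ ℂ x).smulRight w

lemma halfDiskMap_apply (a : ℂ) (x w z : E) :
    halfDiskMap a x w z = star a • z + ((a - star a) * ⟪x, z⟫_ℂ - ⟪w, z⟫_ℂ) • x
      + ⟪x, z⟫_ℂ • w := by
  simp [halfDiskMap]

lemma halfDiskMap_apply_self (a : ℂ) {x w : E} (hx : ‖x‖ = 1) (hxw : ⟪x, w⟫_ℂ = 0) :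
    halfDiskMap a x w x = a • x + w := by
  rw [halfDiskMap_apply, inner_self_eq_norm_sq_to_K, inner_eq_zero_symm.1 hxw, hx]
  simp only [RCLike.ofReal_one, one_pow, mul_one, sub_zero, one_smul, sub_smul]
  abel

lemma re_inner_halfDiskMap (a : ℂ) (x w z : E) :
    (⟪z, halfDiskMap a x w z⟫_ℂ).re = a.re * ‖z‖ ^ 2 := by
  rw [halfDiskMap_apply]
  simp only [inner_add_right, inner_smul_right, inner_self_eq_norm_sq_to_K]
  rw [← inner_conj_symm z x, ← inner_conj_symm z w]
  generalize ⟪x, z⟫_ℂ = p, ⟪w, z⟫_ℂ = q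
  simp [← Complex.ofReal_pow]
  ring

lemma norm_halfDiskMap_sq_le (a : ℂ) {x w : E} (hx : ‖x‖ = 1) (hxw : ⟪x, w⟫_ℂ = 0) (z : E) :
    ‖halfDiskMap a x w z‖ ^ 2 ≤ (‖a‖ ^ 2 + ‖w‖ ^ 2) * ‖z‖ ^ 2 := by
  have hwx : ⟪w, x⟫_ℂ = 0 := inner_eq_zero_symm.1 hxw
  have hxx : ⟪x, x⟫_ℂ = 1 := by simp [inner_self_eq_norm_sq_to_K, hx]
  have heq : ‖halfDiskMap a x w z‖ ^ 2
      = ‖a‖ ^ 2 * ‖z‖ ^ 2 + ‖⟪x, z⟫_ℂ‖ ^ 2 * ‖w‖ ^ 2 + ‖⟪w, z⟫_ℂ‖ ^ 2 := by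
    apply Complex.ofReal_injective
    push_cast
    have hsq : ∀ v : E, (‖v‖ : ℂ) ^ 2 = ⟪v, v⟫_ℂ := fun v => (inner_self_eq_norm_sq_to_K v).symm
    rw [hsq, hsq, hsq, ← Complex.conj_mul', ← Complex.conj_mul', ← Complex.conj_mul',
      halfDiskMap_apply]
    simp only [inner_add_right, inner_add_left, inner_smul_right, inner_smul_left, hwx, hxw, hxx,
      ← inner_conj_symm z x, ← inner_conj_symm z w, RCLike.star_def, map_sub, map_mul,
      Complex.conj_conj]
    ring
  have hh : ‖z - ⟪x, z⟫_ℂ • x‖ ^ 2 = ‖z‖ ^ 2 - ‖⟪x, z⟫_ℂ‖ ^ 2 := by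
    apply Complex.ofReal_injective
    push_cast
    have hsq : ∀ v : E, (‖v‖ : ℂ) ^ 2 = ⟪v, v⟫_ℂ := fun v => (inner_self_eq_norm_sq_to_K v).symm
    rw [hsq, hsq, ← Complex.conj_mul']
    simp only [inner_sub_right, inner_sub_left, inner_smul_right, inner_smul_left, hxx,
      ← inner_conj_symm z x]
    ring
  have hcs : ‖⟪w, z⟫_ℂ‖ ≤ ‖w‖ * ‖z - ⟪x, z⟫_ℂ • x‖ := by
    simpa [inner_sub_right, inner_smul_right, hwx] using norm_inner_le_norm (𝕜 := ℂ) w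
      (z - ⟪x, z⟫_ℂ • x)
  have hcs2 := pow_le_pow_left₀ (norm_nonneg _) hcs 2
  rw [mul_pow, hh] at hcs2
  rw [heq]
  linarith

/-- A half-disk operator interpolating `x ↦ y`. -/
theorem exists_halfDisk_apply_eq {γ : ℝ} {x y : E} (hx : x ≠ 0)
    (hre : 0 ≤ (⟪x, y⟫_ℂ).re) (hnorm : ‖y‖ ^ 2 ≤ γ ^ 2 * ‖x‖ ^ 2) :
    ∃ L : E →ₗ[ℂ] E, L x = y ∧ (∀ z, 0 ≤ (⟪z, L z⟫_ℂ).re) ∧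
      ∀ z, ‖L z‖ ^ 2 ≤ γ ^ 2 * ‖z‖ ^ 2 := by
  have hn : ‖x‖ ≠ 0 := norm_ne_zero_iff.2 hx
  set c : ℂ := ((‖x‖⁻¹ : ℝ) : ℂ) with hc
  have hc0 : c ≠ 0 := by simpa [hc] using hx
  obtain ⟨e, he⟩ : ∃ e, e = c • x := ⟨_, rfl⟩
  obtain ⟨f, hf⟩ : ∃ f, f = c • y := ⟨_, rfl⟩
  have hen : ‖e‖ = 1 := by simp [he, hc, norm_smul, hn]
  have hee : ⟪e, e⟫_ℂ = 1 := by simp [inner_self_eq_norm_sq_to_K, hen]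
  set a := ⟪e, f⟫_ℂ with ha
  have hew : ⟪e, f - a • e⟫_ℂ = 0 := by rw [inner_sub_right, inner_smul_right, hee, ha]; ring
  have hare : 0 ≤ a.re := by
    simp only [ha, he, hf, hc, inner_smul_left, inner_smul_right, Complex.conj_ofReal,
      Complex.re_ofReal_mul]
    positivity
  have hpyth : ‖a‖ ^ 2 + ‖f - a • e‖ ^ 2 = ‖f‖ ^ 2 := by
    have := norm_add_sq_eq_norm_sq_add_norm_sq_of_inner_eq_zero (a • e) (f - a • e)
      (by rw [inner_smul_left, hew, mul_zero])
    rw [add_sub_cancel, norm_smul, hen, mul_one] at this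
    linarith
  have hfn : ‖f‖ ^ 2 ≤ γ ^ 2 := by
    rw [hf, norm_smul, mul_pow, hc, Complex.norm_real, norm_inv, norm_norm, inv_pow,
      inv_mul_le_iff₀ (by positivity)]
    linarith
  refine ⟨halfDiskMap a e (f - a • e), ?_, fun z => ?_, fun z => ?_⟩
  · refine smul_right_injective E hc0 ?_
    simp only
    rw [← map_smul, ← he, ← hf, halfDiskMap_apply_self a hen hew, add_sub_cancel]
  · rw [re_inner_halfDiskMap]
    positivity
  · refine (norm_halfDiskMap_sq_le a hen hew z).trans ?_
    rw [hpyth]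
    gcongr

end Interpolation

section QuadraticForms

variable {n : ℕ}

lemma inner_toEuclideanLin_apply (M : Matrix (Fin n) (Fin n) ℂ) (z : EuclideanSpace ℂ (Fin n)) :
    ⟪z, toEuclideanLin M z⟫_ℂ = star z.ofLp ⬝ᵥ M *ᵥ z.ofLp := by
  rw [EuclideanSpace.inner_eq_star_dotProduct, dotProduct_comm]
  rfl

lemma inner_toEuclideanLin_conjTranspose (M : Matrix (Fin n) (Fin n) ℂ)
    (y z : EuclideanSpace ℂ (Fin n)) :
    ⟪y, toEuclideanLin Mᴴ z⟫_ℂ = ⟪toEuclideanLin M y, z⟫_ℂ := by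
  rw [toEuclideanLin_conjTranspose_eq_adjoint, LinearMap.adjoint_inner_right]

lemma isHermitian_Hpart (M : Matrix (Fin n) (Fin n) ℂ) : (Hpart M).IsHermitian := by
  simp [Matrix.IsHermitian, Hpart, add_comm]

lemma isHermitian_smul_one_sub_smul (r s : ℝ) (M : Matrix (Fin n) (Fin n) ℂ) :
    ((r : ℂ) • (1 : Matrix (Fin n) (Fin n) ℂ) - (s : ℂ) • (Mᴴ * M)).IsHermitian := by
  simp [Matrix.IsHermitian]

lemma inner_Hpart (M : Matrix (Fin n) (Fin n) ℂ) (z : EuclideanSpace ℂ (Fin n)) :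
    ⟪z, toEuclideanLin (Hpart M) z⟫_ℂ = ((⟪z, toEuclideanLin M z⟫_ℂ).re : ℂ) := by
  rw [Hpart, map_smul, map_add, LinearMap.smul_apply, LinearMap.add_apply, inner_smul_right,
    inner_add_right, inner_toEuclideanLin_conjTranspose, ← inner_conj_symm (toEuclideanLin M z) z,
    Complex.add_conj]
  push_cast
  ring

lemma inner_smul_one_sub_smul (r s : ℝ) (M : Matrix (Fin n) (Fin n) ℂ)
    (z : EuclideanSpace ℂ (Fin n)) :
    ⟪z, toEuclideanLin ((r : ℂ) • (1 : Matrix (Fin n) (Fin n) ℂ) - (s : ℂ) • (Mᴴ * M)) z⟫_ℂ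
      = ((r * ‖z‖ ^ 2 - s * ‖toEuclideanLin M z‖ ^ 2 : ℝ) : ℂ) := by
  have hmul : toEuclideanLin (Mᴴ * M) z = toEuclideanLin Mᴴ (toEuclideanLin M z) := by
    simp [toEuclideanLin]
  have hone : toEuclideanLin (1 : Matrix (Fin n) (Fin n) ℂ) z = z := by simp [toEuclideanLin]
  rw [map_sub, map_smul, map_smul, LinearMap.sub_apply, LinearMap.smul_apply,
    LinearMap.smul_apply, hmul, hone, inner_sub_right, inner_smul_right, inner_smul_right,
    inner_toEuclideanLin_conjTranspose, inner_self_eq_norm_sq_to_K, inner_self_eq_norm_sq_to_K]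
  push_cast
  rfl

lemma posSemidef_iff_inner {M : Matrix (Fin n) (Fin n) ℂ} (hM : M.IsHermitian) :
    M.PosSemidef ↔ ∀ z : EuclideanSpace ℂ (Fin n), 0 ≤ ⟪z, toEuclideanLin M z⟫_ℂ := by
  rw [posSemidef_iff_dotProduct_mulVec, and_iff_right hM]
  simp only [inner_toEuclideanLin_apply]
  exact ⟨fun h z => h z.ofLp, fun h z => h (WithLp.toLp 2 z)⟩

lemma posDef_iff_inner {M : Matrix (Fin n) (Fin n) ℂ} (hM : M.IsHermitian) :
    M.PosDef ↔ ∀ z : EuclideanSpace ℂ (Fin n), z ≠ 0 → 0 < ⟪z, toEuclideanLin M z⟫_ℂ := by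
  rw [posDef_iff_dotProduct_mulVec, and_iff_right hM]
  simp only [inner_toEuclideanLin_apply]
  exact ⟨fun h z hz => h (by simpa using hz), fun h z hz => h (WithLp.toLp 2 z) (by simpa using hz)⟩

lemma posSemidef_Hpart_iff (M : Matrix (Fin n) (Fin n) ℂ) :
    (Hpart M).PosSemidef ↔
      ∀ z : EuclideanSpace ℂ (Fin n), 0 ≤ (⟪z, toEuclideanLin M z⟫_ℂ).re := by
  simp only [posSemidef_iff_inner (isHermitian_Hpart M), inner_Hpart, Complex.zero_le_real]

lemma posSemidef_sub_conjTranspose_mul_iff (r : ℝ) (M : Matrix (Fin n) (Fin n) ℂ) :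
    ((r : ℂ) • (1 : Matrix (Fin n) (Fin n) ℂ) - Mᴴ * M).PosSemidef ↔
      ∀ z : EuclideanSpace ℂ (Fin n), ‖toEuclideanLin M z‖ ^ 2 ≤ r * ‖z‖ ^ 2 := by
  have h := posSemidef_iff_inner (isHermitian_smul_one_sub_smul r 1 M)
  simp only [inner_smul_one_sub_smul, Complex.zero_le_real, one_mul, sub_nonneg] at h
  simpa only [Complex.ofReal_one, one_smul] using h

lemma posDef_lmi_iff (k₁ k₂ s : ℝ) (M : Matrix (Fin n) (Fin n) ℂ) :
    (k₁ • ((1 : Matrix (Fin n) (Fin n) ℂ) - (s : ℂ) • (Mᴴ * M)) + k₂ • Hpart M).PosDef ↔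
      ∀ z : EuclideanSpace ℂ (Fin n), z ≠ 0 →
        0 < k₁ * (‖z‖ ^ 2 - s * ‖toEuclideanLin M z‖ ^ 2)
          + k₂ * (⟪z, toEuclideanLin M z⟫_ℂ).re := by
  have hone : (1 : Matrix (Fin n) (Fin n) ℂ) - (s : ℂ) • (Mᴴ * M)
      = ((1 : ℝ) : ℂ) • (1 : Matrix (Fin n) (Fin n) ℂ) - (s : ℂ) • (Mᴴ * M) := by simp
  have hherm : ((k₁ : ℂ) • (((1 : ℝ) : ℂ) • (1 : Matrix (Fin n) (Fin n) ℂ) - (s : ℂ) • (Mᴴ * M))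
      + (k₂ : ℂ) • Hpart M).IsHermitian := by
    refine .add ?_ ?_
    · simp [Matrix.IsHermitian]
    · rw [Matrix.IsHermitian, conjTranspose_smul, (isHermitian_Hpart M).eq]
      simp
  rw [hone, ← Complex.coe_smul, ← Complex.coe_smul, posDef_iff_inner hherm]
  refine forall₂_congr fun z _ => ?_
  rw [map_add, map_smul, map_smul, LinearMap.add_apply, LinearMap.smul_apply,
    LinearMap.smul_apply, inner_add_right, inner_smul_right, inner_smul_right,
    inner_smul_one_sub_smul, inner_Hpart, one_mul, ← Complex.ofReal_mul, ← Complex.ofReal_mul,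
    ← Complex.ofReal_add, Complex.zero_lt_real]

lemma det_one_add_mul_eq_zero_iff (A B : Matrix (Fin n) (Fin n) ℂ) :
    (1 + A * B).det = 0 ↔ ∃ x : EuclideanSpace ℂ (Fin n), x ≠ 0 ∧
      toEuclideanLin A (toEuclideanLin B x) = -x := by
  rw [← exists_mulVec_eq_zero_iff]
  constructor
  · rintro ⟨v, hv, h⟩
    refine ⟨WithLp.toLp 2 v, by simpa using hv, ?_⟩
    rw [add_mulVec, one_mulVec, ← mulVec_mulVec, add_comm, ← eq_neg_iff_add_eq_zero] at h
    exact congrArg (WithLp.toLp 2) h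
  · rintro ⟨x, hx, h⟩
    refine ⟨x.ofLp, by simpa using hx, ?_⟩
    rw [add_mulVec, one_mulVec, ← mulVec_mulVec, add_comm, ← eq_neg_iff_add_eq_zero]
    exact congrArg WithLp.ofLp h

end QuadraticForms

/-- Solution of the matrix half-disk problem: for invertible `A`, `det(I + A·B) ≠ 0` for
all half-disk matrices `B ∈ S_γ(π/2)` iff the two-term LMI is feasible. -/
theorem half_disk_iff_lmi {n : ℕ} (hn : 3 ≤ n) (γ : ℝ) (hγ : 0 < γ)
    (A : Matrix (Fin n) (Fin n) ℂ) (hA : IsUnit A.det) :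
    (∀ B : Matrix (Fin n) (Fin n) ℂ, (Hpart B).PosSemidef →
        (((γ ^ 2 : ℝ) : ℂ) • (1 : Matrix (Fin n) (Fin n) ℂ) - Bᴴ * B).PosSemidef →
        (1 + A * B).det ≠ 0) ↔
      ∃ k₁ k₂ : ℝ, 0 ≤ k₁ ∧ 0 ≤ k₂ ∧
        (k₁ • ((1 : Matrix (Fin n) (Fin n) ℂ) - ((γ ^ 2 : ℝ) : ℂ) • (Aᴴ * A))
          + k₂ • Hpart A).PosDef := by
  simp only [posDef_lmi_iff, posSemidef_Hpart_iff, posSemidef_sub_conjTranspose_mul_iff]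
  constructor
  · intro h
    set T : EuclideanSpace ℂ (Fin n) →ₗ[ℂ] EuclideanSpace ℂ (Fin n) :=
      toEuclideanLin (((1 : ℝ) : ℂ) • 1 - ((γ ^ 2 : ℝ) : ℂ) • (Aᴴ * A))
        + Complex.I • toEuclideanLin (Hpart A) with hT
    have hTz : ∀ z, ⟪z, T z⟫_ℂ = ((‖z‖ ^ 2 - γ ^ 2 * ‖toEuclideanLin A z‖ ^ 2 : ℝ) : ℂ)
        + Complex.I * ((⟪z, toEuclideanLin A z⟫_ℂ).re : ℂ) := by
      intro z
      rw [hT, LinearMap.add_apply, LinearMap.smul_apply, inner_add_right, inner_smul_right,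
        inner_smul_one_sub_smul, inner_Hpart, one_mul]
    have hre : ∀ z, (⟪z, T z⟫_ℂ).re = ‖z‖ ^ 2 - γ ^ 2 * ‖toEuclideanLin A z‖ ^ 2 := fun z => by
      rw [hTz, Complex.add_re, Complex.ofReal_re, Complex.re_mul_ofReal]; simp
    have him : ∀ z, (⟪z, T z⟫_ℂ).im = (⟪z, toEuclideanLin A z⟫_ℂ).re := fun z => by
      rw [hTz, Complex.add_im, Complex.ofReal_im, Complex.im_mul_ofReal]; simp
    have hpos := exists_nonneg_combination_pos T fun y hy hq => by
      rw [hre, him] at hq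
      have hx : -toEuclideanLin A y ≠ 0 := fun h0 => by
        have : ‖y‖ ^ 2 ≤ 0 := by simpa [neg_eq_zero.1 h0] using hq.1
        exact hy (by simpa using le_antisymm this (sq_nonneg _))
      obtain ⟨L, hLx, hLre, hLn⟩ := exists_halfDisk_apply_eq (γ := γ) (y := y) hx
        (by rw [← inner_conj_symm, Complex.conj_re, inner_neg_right, Complex.neg_re]; linarith)
        (by rw [norm_neg]; linarith)
      refine h (toEuclideanLin.symm L) (by simpa using hLre) (by simpa using hLn) ?_
      rw [det_one_add_mul_eq_zero_iff]
      exact ⟨_, hx, by rw [LinearEquiv.apply_symm_apply, hLx, neg_neg]⟩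
    simpa only [hre, him] using hpos
  · rintro ⟨k₁, k₂, hk₁, hk₂, h⟩ B hB hBn hdet
    obtain ⟨x, hx, hABx⟩ := (det_one_add_mul_eq_zero_iff A B).1 hdet
    have hBx : toEuclideanLin B x ≠ 0 := fun h0 => by simp [h0, hx] at hABx
    have hlt := h _ hBx
    rw [hABx, norm_neg, inner_neg_right, ← inner_conj_symm, Complex.neg_re, Complex.conj_re] at hlt
    have h1 := mul_nonneg hk₁ (sub_nonneg.2 (hBn x))
    have h2 := mul_nonneg hk₂ (hB x)
    linarith
end
end

section
/- Let n ≥ 1, γ > 0 and let α, β be real numbers with −π ≤ (α+β)/2 < π and 0 < β−α < π, and let C be an n×n complex matrix. Then det(C + B) ≠ 0 for every matrix B ∈ S_γ(α,β) if and only if DW(−C) ∩ (⋃_{B ∈ S_γ(α,β)} DW(B)) = ∅. -/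
open Matrix
open scoped ComplexOrder

noncomputable section

/-- Membership in the sectored-disk set `S_γ(α,β)`. -/
def memSDab {n : ℕ} (γ α β : ℝ) (B : Matrix (Fin n) (Fin n) ℂ) : Prop :=
  (((γ ^ 2 : ℝ) : ℂ) • (1 : Matrix (Fin n) (Fin n) ℂ) - Bᴴ * B).PosSemidef ∧
  (Hpart (Complex.exp (Complex.I * ((Real.pi / 2 - β : ℝ) : ℂ)) • B)).PosSemidef ∧
  (Hpart (Complex.exp (-Complex.I * ((Real.pi / 2 + α : ℝ) : ℂ)) • B)).PosSemidef

/-- The Davis–Wielandt shell of a complex matrix, as a subset of `ℝ × ℝ × ℝ`. -/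
def DW {n : ℕ} (A : Matrix (Fin n) (Fin n) ℂ) : Set (ℝ × ℝ × ℝ) :=
  {p | ∃ u : Fin n → ℂ, star u ⬝ᵥ u = 1 ∧
    p = ((star u ⬝ᵥ A.mulVec u).re, (star u ⬝ᵥ A.mulVec u).im,
         (star (A.mulVec u) ⬝ᵥ A.mulVec u).re)}

/-- Two linear maps into a finite-dimensional inner product space with pointwise equal norms
differ by a linear isometric automorphism of the codomain. -/
theorem exists_linearIsometryEquiv_comp_eq {W V : Type*} [AddCommGroup W] [Module ℂ W]
    [NormedAddCommGroup V] [InnerProductSpace ℂ V] [FiniteDimensional ℂ V]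
    (f g : W →ₗ[ℂ] V) (h : ∀ w, ‖f w‖ = ‖g w‖) :
    ∃ e : V ≃ₗᵢ[ℂ] V, ∀ w, e (f w) = g w := by
  obtain ⟨s, hs⟩ := f.rangeRestrict.exists_rightInverse_of_surjective f.range_rangeRestrict
  have hs' : ∀ y, f (s y) = y := fun y => congrArg Subtype.val (LinearMap.congr_fun hs y)
  let L : LinearMap.range f →ₗᵢ[ℂ] V :=
    ⟨g ∘ₗ s, fun y => by rw [LinearMap.comp_apply, ← h, hs', Submodule.coe_norm]⟩
  refine ⟨L.extend.toLinearIsometryEquiv rfl, fun w => ?_⟩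
  have hL : L.extend (f w) = g (s (f.rangeRestrict w)) := L.extend_apply (f.rangeRestrict w)
  rw [LinearIsometry.toLinearIsometryEquiv_apply, hL, ← sub_eq_zero, ← map_sub, ← norm_eq_zero,
    ← h, map_sub, hs', LinearMap.codRestrict_apply, sub_self, norm_zero]

/-- Two pairs of vectors with the same Gram matrix are related by a linear isometric
automorphism. -/
theorem exists_linearIsometryEquiv_apply_pair {V : Type*}
    [NormedAddCommGroup V] [InnerProductSpace ℂ V] [FiniteDimensional ℂ V] {x y x' y' : V}
    (hx : ‖x‖ = ‖x'‖) (hy : ‖y‖ = ‖y'‖) (hxy : inner ℂ x y = inner ℂ x' y') :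
    ∃ e : V ≃ₗᵢ[ℂ] V, e x = x' ∧ e y = y' := by
  obtain ⟨e, he⟩ := exists_linearIsometryEquiv_comp_eq
    ((LinearMap.toSpanSingleton ℂ V x).coprod (LinearMap.toSpanSingleton ℂ V y))
    ((LinearMap.toSpanSingleton ℂ V x').coprod (LinearMap.toSpanSingleton ℂ V y'))
    (fun w => by
      rw [← sq_eq_sq₀ (norm_nonneg _) (norm_nonneg _)]
      simp only [LinearMap.coprod_apply, LinearMap.toSpanSingleton_apply]
      rw [norm_add_sq (𝕜 := ℂ), norm_add_sq (𝕜 := ℂ)]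
      simp only [norm_smul, inner_smul_left, inner_smul_right, hx, hy, hxy])
  exact ⟨e, by simpa using he (1, 0), by simpa using he (0, 1)⟩

/-- Two pairs of vectors in `ℂⁿ` with the same Gram matrix are related by a unitary matrix. -/
theorem exists_unitary_mulVec_pair {n : ℕ} {x y x' y' : Fin n → ℂ}
    (hx : star x ⬝ᵥ x = star x' ⬝ᵥ x') (hy : (star y ⬝ᵥ y).re = (star y' ⬝ᵥ y').re)
    (hxy : star x ⬝ᵥ y = star x' ⬝ᵥ y') :
    ∃ U ∈ unitaryGroup (Fin n) ℂ, U *ᵥ x = x' ∧ U *ᵥ y = y' := by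
  have hnorm : ∀ z z' : Fin n → ℂ, (star z ⬝ᵥ z).re = (star z' ⬝ᵥ z').re →
      ‖WithLp.toLp 2 z‖ = ‖WithLp.toLp 2 z'‖ := fun z z' h => by
    rw [← sq_eq_sq₀ (norm_nonneg _) (norm_nonneg _), norm_sq_eq_re_inner (𝕜 := ℂ),
      norm_sq_eq_re_inner (𝕜 := ℂ), EuclideanSpace.inner_eq_star_dotProduct,
      EuclideanSpace.inner_eq_star_dotProduct, dotProduct_comm, dotProduct_comm z']
    exact h
  obtain ⟨e, hex, hey⟩ := exists_linearIsometryEquiv_apply_pair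
    (hnorm x x' (congrArg Complex.re hx)) (hnorm y y' hy) (by
      rw [EuclideanSpace.inner_eq_star_dotProduct, EuclideanSpace.inner_eq_star_dotProduct,
        dotProduct_comm, dotProduct_comm y']
      exact hxy)
  let T := Matrix.toEuclideanCLM (n := Fin n) (𝕜 := ℂ)
  let E := Unitary.linearIsometryEquiv.symm e
  have hU : ∀ z : Fin n → ℂ, WithLp.toLp 2 (T.symm E *ᵥ z) = e (WithLp.toLp 2 z) := fun z => by
    rw [← Matrix.toEuclideanCLM_toLp]
    change T (T.symm E) _ = _
    rw [StarAlgEquiv.apply_symm_apply]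
    rfl
  exact ⟨T.symm E, Unitary.map_mem T.symm E.2,
    WithLp.toLp_injective 2 ((hU x).trans hex), WithLp.toLp_injective 2 ((hU y).trans hey)⟩

theorem Hpart_smul_conj {n : ℕ} (c : ℂ) (U B : Matrix (Fin n) (Fin n) ℂ) :
    Hpart (c • (U * B * Uᴴ)) = U * Hpart (c • B) * Uᴴ := by
  simp [Hpart, mul_add, add_mul, Matrix.mul_assoc]

theorem memSDab.unitary_conj {n : ℕ} {γ α β : ℝ} {U B : Matrix (Fin n) (Fin n) ℂ}
    (hU : U ∈ unitaryGroup (Fin n) ℂ) (hB : memSDab γ α β B) :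
    memSDab γ α β (U * B * Uᴴ) := by
  obtain ⟨h₁, h₂, h₃⟩ := hB
  have hU₁ : Uᴴ * U = 1 := mem_unitaryGroup_iff'.mp hU
  have hU₂ : U * Uᴴ = 1 := mem_unitaryGroup_iff.mp hU
  refine ⟨?_, ?_, ?_⟩
  · convert h₁.mul_mul_conjTranspose_same U using 1
    have h : (U * B * Uᴴ)ᴴ * (U * B * Uᴴ) = U * Bᴴ * (Uᴴ * U) * B * Uᴴ := by
      simp [Matrix.mul_assoc]
    rw [h, hU₁]
    simp [mul_sub, sub_mul, Matrix.mul_assoc, hU₂]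
  · rw [Hpart_smul_conj]
    exact h₂.mul_mul_conjTranspose_same U
  · rw [Hpart_smul_conj]
    exact h₃.mul_mul_conjTranspose_same U

/-- A singular complex matrix annihilates a unit vector. -/
theorem exists_unit_mulVec_eq_zero {n : ℕ} {M : Matrix (Fin n) (Fin n) ℂ} (hM : M.det = 0) :
    ∃ u : Fin n → ℂ, star u ⬝ᵥ u = 1 ∧ M *ᵥ u = 0 := by
  obtain ⟨v, hv, hMv⟩ := exists_mulVec_eq_zero_iff.mpr hM
  have hv' : WithLp.toLp 2 v ≠ 0 := by simpa using hv
  have hone : ‖(‖WithLp.toLp 2 v‖ : ℂ)⁻¹ • WithLp.toLp 2 v‖ = 1 := norm_smul_inv_norm hv'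
  have h := inner_self_eq_norm_sq_to_K (𝕜 := ℂ) ((‖WithLp.toLp 2 v‖ : ℂ)⁻¹ • WithLp.toLp 2 v)
  rw [hone, EuclideanSpace.inner_eq_star_dotProduct, dotProduct_comm] at h
  exact ⟨(‖WithLp.toLp 2 v‖ : ℂ)⁻¹ • v, h.trans (by simp), by rw [mulVec_smul, hMv, smul_zero]⟩

/-- `det(C + B) ≠ 0` for all `B ∈ S_γ(α,β)` iff `DW(−C)` is disjoint from the union of
DW shells of matrices in `S_γ(α,β)`. -/
theorem det_ne_zero_iff_dw_disjoint {n : ℕ} (hn : 1 ≤ n) (γ α β : ℝ) (hγ : 0 < γ)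
    (hαβ₁ : -Real.pi ≤ (α + β) / 2) (hαβ₂ : (α + β) / 2 < Real.pi)
    (hαβ₃ : 0 < β - α) (hαβ₄ : β - α < Real.pi)
    (C : Matrix (Fin n) (Fin n) ℂ) :
    (∀ B : Matrix (Fin n) (Fin n) ℂ, memSDab γ α β B → (C + B).det ≠ 0) ↔
      DW (-C) ∩ (⋃ B ∈ {B : Matrix (Fin n) (Fin n) ℂ | memSDab γ α β B}, DW B) = ∅ := by
  constructor
  · intro hdet
    rw [Set.eq_empty_iff_forall_notMem]
    rintro p ⟨⟨u, hu, rfl⟩, hp⟩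
    obtain ⟨B, hB, v, hv, huv⟩ := Set.mem_iUnion₂.mp hp
    obtain ⟨hre, him, hnorm⟩ : _ ∧ _ ∧ _ := by simpa only [Prod.mk.injEq] using huv
    obtain ⟨U, hU, hUv, hUB⟩ := exists_unitary_mulVec_pair (hv.trans hu.symm) hnorm.symm
      (Complex.ext hre him).symm
    refine hdet (U * B * Uᴴ) (memSDab.unitary_conj hU hB)
      (exists_mulVec_eq_zero_iff.mp ⟨u, ?_, ?_⟩)
    · rintro rfl
      simp at hu
    · have hUu : Uᴴ *ᵥ u = v := by
        rw [← hUv, mulVec_mulVec, ← star_eq_conjTranspose, mem_unitaryGroup_iff'.mp hU,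
          one_mulVec]
      rw [add_mulVec, ← mulVec_mulVec, ← mulVec_mulVec, hUu, hUB, neg_mulVec, add_neg_cancel]
  · intro hdisj B hB hdet
    obtain ⟨u, hu, hCBu⟩ := exists_unit_mulVec_eq_zero hdet
    have hBu : (-C) *ᵥ u = B *ᵥ u := by
      rw [neg_mulVec, neg_eq_iff_add_eq_zero, ← add_mulVec, hCBu]
    refine (Set.eq_empty_iff_forall_notMem.mp hdisj) _
      ⟨⟨u, hu, rfl⟩, Set.mem_iUnion₂.mpr ⟨B, hB, u, hu, ?_⟩⟩
    rw [hBu]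
end
end
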